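/- The function z(x) = f''(x)/(2 f(x)), where f(x) = σ(u - x) e^{ζ(u)x} / (σ(u)σ(x)), equals ℘(x) + ℘(u)/2. -/

import Mathlib

open scoped BigOperators

/-- The period lattice generated by `ω₁`, `ω₂`. -/
noncomputable def wLattice (ω₁ ω₂ : ℂ) : AddSubgroup ℂ := AddSubgroup.closure {ω₁, ω₂}

/-- The nonzero lattice points. -/
noncomputable def wLatticeStar (ω₁ ω₂ : ℂ) : Type := {w : ℂ // w ∈ wLattice ω₁ ω₂ ∧ w ≠ 0}

/-- The Weierstrass sigma function of the lattice. -/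
noncomputable def wSigma (ω₁ ω₂ : ℂ) (z : ℂ) : ℂ :=
  z * ∏' w : wLatticeStar ω₁ ω₂,
    (1 - z / w.1) * Complex.exp (z / w.1 + z ^ 2 / (2 * w.1 ^ 2))

/-- The Weierstrass zeta function of the lattice. -/
noncomputable def wZeta (ω₁ ω₂ : ℂ) (z : ℂ) : ℂ :=
  z⁻¹ + ∑' w : wLatticeStar ω₁ ω₂, ((z - w.1)⁻¹ + (w.1)⁻¹ + z / w.1 ^ 2)

/-- The Weierstrass `℘`-function of the lattice. -/
noncomputable def wP (ω₁ ω₂ : ℂ) (z : ℂ) : ℂ :=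
  (z ^ 2)⁻¹ + ∑' w : wLatticeStar ω₁ ω₂, (((z - w.1) ^ 2)⁻¹ - (w.1 ^ 2)⁻¹)

/-- The Calogero-Moser function `f(x) = σ(u-x) e^{ζ(u) x} / (σ(u) σ(x))`. -/
noncomputable def cmF (ω₁ ω₂ u : ℂ) (x : ℂ) : ℂ :=
  wSigma ω₁ ω₂ (u - x) * Complex.exp (wZeta ω₁ ω₂ u * x) /
    (wSigma ω₁ ω₂ u * wSigma ω₁ ω₂ x)

open Filter Topology

namespace PeriodPair

variable (L : PeriodPair)

/-- The Weierstrass `ζ`-function of `L` with its pole at the origin removed. -/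
noncomputable def zetaRegular (z : ℂ) : ℂ :=
  ∑' l : L.lattice, if l.1 = 0 then 0 else ((z - l.1)⁻¹ + (l.1)⁻¹ + z / l.1 ^ 2)

/-- The Weierstrass `ζ`-function of `L`. -/
noncomputable def zeta (z : ℂ) : ℂ := z⁻¹ + L.zetaRegular z

lemma zetaRegular_summand_bound {r : ℝ} (hr : 0 < r) {z : ℂ} (hz : ‖z‖ < r) {l : ℂ}
    (h : 2 * r ≤ ‖l‖) :
    ‖(z - l)⁻¹ + l⁻¹ + z / l ^ 2‖ ≤ 2 * r ^ 2 * ‖l‖ ^ (-3 : ℝ) := by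
  have hl : 0 < ‖l‖ := by linarith
  have hl0 : l ≠ 0 := norm_pos_iff.mp hl
  have hzl : ‖l‖ / 2 ≤ ‖z - l‖ := by
    rw [norm_sub_rev]
    exact .trans (by linarith) (norm_sub_norm_le l z)
  have hzl0 : z - l ≠ 0 := norm_pos_iff.mp (by linarith)
  have key : (z - l)⁻¹ + l⁻¹ + z / l ^ 2 = z ^ 2 / ((z - l) * l ^ 2) := by
    field_simp
    ring
  calc _ = ‖z‖ ^ 2 / (‖z - l‖ * ‖l‖ ^ 2) := by rw [key]; simp
    _ ≤ r ^ 2 / (‖l‖ / 2 * ‖l‖ ^ 2) := by gcongr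
    _ = 2 * r ^ 2 / ‖l‖ ^ 3 := by field
    _ = _ := by norm_cast

lemma hasSumLocallyUniformly_zetaRegular :
    HasSumLocallyUniformly (fun (l : L.lattice) (z : ℂ) ↦
      if l.1 = 0 then 0 else ((z - l.1)⁻¹ + (l.1)⁻¹ + z / l.1 ^ 2)) L.zetaRegular := by
  refine L.hasSumLocallyUniformly_aux (u := fun r l ↦ 2 * r ^ 2 * ‖l‖ ^ (-3 : ℝ)) _
    (fun _ _ ↦ (ZLattice.summable_norm_rpow _ _ (by simp; norm_num)).mul_left _) fun r hr ↦
    Filter.eventually_atTop.mpr ⟨2 * r, ?_⟩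
  rintro _ h s hs l rfl
  split_ifs
  · rw [norm_zero]
    positivity
  · exact zetaRegular_summand_bound hr hs h

lemma hasDerivAt_zetaRegular_summand {l z : ℂ} (h : z ≠ l) :
    HasDerivAt (fun z ↦ (z - l)⁻¹ + l⁻¹ + z / l ^ 2) (-(1 / (z - l) ^ 2 - 1 / l ^ 2)) z := by
  have h1 := (((hasDerivAt_id z).sub_const l).fun_inv (sub_ne_zero.mpr h)).add_const l⁻¹
  refine (h1.add ((hasDerivAt_id z).div_const (l ^ 2))).congr_deriv ?_
  simp only [id]
  ring

lemma hasDerivAt_zetaRegular {z : ℂ} (hz : z ∈ ((L.lattice : Set ℂ) \ {0})ᶜ) :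
    HasDerivAt L.zetaRegular (-L.weierstrassPExcept 0 z) z := by
  have hsum (l : L.lattice) (w : ℂ) (hw : w ∈ ((L.lattice : Set ℂ) \ {0})ᶜ) :
      HasDerivAt (fun z ↦ if l.1 = 0 then 0 else ((z - l.1)⁻¹ + (l.1)⁻¹ + z / l.1 ^ 2))
        (-(if l.1 = 0 then 0 else (1 / (w - l) ^ 2 - 1 / l.1 ^ 2))) w := by
    split_ifs with hl
    · simpa using hasDerivAt_const w (0 : ℂ)
    · refine hasDerivAt_zetaRegular_summand ?_
      rintro rfl
      simp [hl] at hw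
  refine hasDerivAt_of_tendstoLocallyUniformlyOn (l := atTop) L.isOpen_compl_lattice_sdiff
    (f := fun (s : Finset L.lattice) z ↦ ∑ l ∈ s,
      if l.1 = 0 then 0 else ((z - l.1)⁻¹ + (l.1)⁻¹ + z / l.1 ^ 2))
    (f' := fun s z ↦ -∑ l ∈ s, if l.1 = 0 then 0 else (1 / (z - l) ^ 2 - 1 / l.1 ^ 2))
    (g' := fun z ↦ -L.weierstrassPExcept 0 z)
    ?_ (.of_forall fun s w hw ↦ ?_) (fun w _ ↦ ?_) hz
  · exact (L.hasSumLocallyUniformly_weierstrassPExcept 0).tendstoLocallyUniformlyOn.neg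
  · rw [← Finset.sum_neg_distrib]
    exact HasDerivAt.fun_sum fun l _ ↦ hsum l w hw
  · exact L.hasSumLocallyUniformly_zetaRegular.hasSum

@[simp]
lemma zetaRegular_zero : L.zetaRegular 0 = 0 := by simp [zetaRegular]

lemma weierstrassP_eq_add_weierstrassPExcept_zero (z : ℂ) :
    L.weierstrassP z = (z ^ 2)⁻¹ + L.weierstrassPExcept 0 z := by
  rw [← L.weierstrassPExcept_add 0 z]
  simp [add_comm]

lemma hasDerivAt_zeta {z : ℂ} (hz : z ∉ L.lattice) :
    HasDerivAt L.zeta (-L.weierstrassP z) z := by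
  have hz0 : z ≠ 0 := fun h ↦ hz (h ▸ zero_mem _)
  refine ((hasDerivAt_inv hz0).add
    (L.hasDerivAt_zetaRegular (z := z) fun h ↦ hz h.1)).congr_deriv ?_
  rw [weierstrassP_eq_add_weierstrassPExcept_zero]
  ring

lemma exists_zeta_add_coe (l : L.lattice) :
    ∃ η, ∀ z ∉ L.lattice, L.zeta (z + l) = L.zeta z + η := by
  have hadd {z : ℂ} (hz : z ∉ L.lattice) : z + l ∉ L.lattice := fun h ↦
    hz (by simpa using sub_mem h l.2)
  have hcount : (L.lattice : Set ℂ).Countable := by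
    have : Countable L.lattice := L.latticeEquivProd.toEquiv.countable_iff.mpr inferInstance
    exact Set.to_countable _
  have hconn : IsPreconnected (L.lattice : Set ℂ)ᶜ :=
    (hcount.isConnected_compl_of_one_lt_rank (by simp)).isPreconnected
  have hder {z : ℂ} (hz : z ∉ L.lattice) :
      HasDerivAt (fun z ↦ L.zeta (z + l) - L.zeta z) 0 z := by
    refine (((L.hasDerivAt_zeta (hadd hz)).comp_add_const z l.1).sub
      (L.hasDerivAt_zeta hz)).congr_deriv ?_
    simp
  obtain ⟨η, hη⟩ := L.isClosed_lattice.isOpen_compl.exists_is_const_of_deriv_eq_zero hconn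
    (fun z hz ↦ (hder hz).differentiableAt.differentiableWithinAt) (fun z hz ↦ (hder hz).deriv)
  exact ⟨η, fun z hz ↦ by rw [← hη z hz]; ring⟩

/-- The Weierstrass `σ`-function of `L`, divided by the identity function. -/
noncomputable def sigmaRegular (z : ℂ) : ℂ :=
  ∏' l : L.lattice, (1 - z / l.1) * Complex.exp (z / l.1 + z ^ 2 / (2 * l.1 ^ 2))

/-- The Weierstrass `σ`-function of `L`. -/
noncomputable def sigma (z : ℂ) : ℂ := z * L.sigmaRegular z

lemma hasDerivAt_one_sub_mul_exp (t : ℂ) :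
    HasDerivAt (fun t : ℂ ↦ (1 - t) * Complex.exp (t + t ^ 2 / 2))
      (-t ^ 2 * Complex.exp (t + t ^ 2 / 2)) t := by
  have h1 : HasDerivAt (fun t : ℂ ↦ 1 - t) (-1) t := (hasDerivAt_id t).const_sub 1
  have h2 : HasDerivAt (fun t : ℂ ↦ t + t ^ 2 / 2) (1 + t) t := by
    refine ((hasDerivAt_id t).add ((hasDerivAt_pow 2 t).div_const 2)).congr_deriv ?_
    simp
  refine (h1.mul h2.cexp).congr_deriv ?_
  ring

lemma norm_one_sub_mul_exp_sub_one_le {t : ℂ} (ht : ‖t‖ ≤ 1) :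
    ‖(1 - t) * Complex.exp (t + t ^ 2 / 2) - 1‖ ≤ Real.exp 2 * ‖t‖ ^ 3 := by
  have key := (convex_closedBall (0 : ℂ) ‖t‖).norm_image_sub_le_of_norm_hasDerivWithin_le
    (f := fun t : ℂ ↦ (1 - t) * Complex.exp (t + t ^ 2 / 2)) (C := ‖t‖ ^ 2 * Real.exp 2)
    (x := 0) (y := t) (fun s _ ↦ (hasDerivAt_one_sub_mul_exp s).hasDerivWithinAt)
    (fun s hs ↦ ?_) (by simp) (by simp)
  · refine (le_of_eq (by simp)).trans (key.trans (le_of_eq ?_))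
    simp only [sub_zero]
    ring
  · have hs' : ‖s‖ ≤ ‖t‖ := by simpa using hs
    have hs1 : ‖s‖ ≤ 1 := hs'.trans ht
    rw [norm_mul, norm_neg, norm_pow]
    gcongr
    refine (Complex.norm_exp_le_exp_norm _).trans (Real.exp_le_exp.mpr ?_)
    calc ‖s + s ^ 2 / 2‖ ≤ ‖s‖ + ‖s‖ ^ 2 / 2 := (norm_add_le _ _).trans (by simp)
      _ ≤ 2 := by nlinarith [norm_nonneg s]

lemma sigma_factor_eq_add (l z : ℂ) :
    (1 - z / l) * Complex.exp (z / l + z ^ 2 / (2 * l ^ 2)) =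
      1 + ((1 - z / l) * Complex.exp (z / l + (z / l) ^ 2 / 2) - 1) := by
  rw [div_pow, div_div, mul_comm (l ^ 2)]
  ring

lemma summable_sigma_bound (r : ℝ) :
    Summable fun l : L.lattice ↦ Real.exp 2 * r ^ 3 * ‖l‖ ^ (-3 : ℝ) :=
  (ZLattice.summable_norm_rpow _ _ (by simp; norm_num)).mul_left _

lemma eventually_norm_sigma_factor_sub_one_le {r : ℝ} (hr : 0 < r) :
    ∀ᶠ l : L.lattice in cofinite, ∀ z ∈ Metric.ball (0 : ℂ) r,
      ‖(1 - z / l.1) * Complex.exp (z / l.1 + (z / l.1) ^ 2 / 2) - 1‖ ≤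
        Real.exp 2 * r ^ 3 * ‖l‖ ^ (-3 : ℝ) := by
  refine (isCompact_iff_finite.mp (isCompact_closedBall (0 : L.lattice) r)).subset ?_
  intro l hl
  contrapose! hl
  have hrl : r < ‖l.1‖ := by simpa using hl
  simp only [Set.mem_compl_iff, Set.mem_ofPred_eq, not_not]
  intro z hz
  have hz : ‖z‖ < r := by simpa using hz
  have hl0 : 0 < ‖l.1‖ := hr.trans hrl
  refine (norm_one_sub_mul_exp_sub_one_le ?_).trans ?_
  · rw [norm_div, div_le_one hl0]
    linarith
  · rw [norm_div, div_pow, mul_div_assoc', div_eq_mul_inv]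
    have : ‖l‖ ^ (-3 : ℝ) = (‖l.1‖ ^ 3)⁻¹ := by norm_cast
    rw [this]
    gcongr

lemma hasProdLocallyUniformlyOn_sigmaRegular {r : ℝ} (hr : 0 < r) :
    HasProdLocallyUniformlyOn (fun (l : L.lattice) (z : ℂ) ↦
      (1 - z / l.1) * Complex.exp (z / l.1 + z ^ 2 / (2 * l.1 ^ 2))) L.sigmaRegular
      (Metric.ball 0 r) := by
  unfold sigmaRegular
  simp_rw [sigma_factor_eq_add]
  exact (L.summable_sigma_bound r).hasProdLocallyUniformlyOn_one_add Metric.isOpen_ball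
    (L.eventually_norm_sigma_factor_sub_one_le hr) fun l ↦ by fun_prop

lemma sigma_factor_ne_zero {z : ℂ} (hz : z ∉ L.lattice) (l : L.lattice) :
    (1 - z / l.1) * Complex.exp (z / l.1 + z ^ 2 / (2 * l.1 ^ 2)) ≠ 0 := by
  refine mul_ne_zero (fun h ↦ hz ?_) (Complex.exp_ne_zero _)
  have hl : l.1 ≠ 0 := fun hl ↦ by simp [hl] at h
  rw [sub_eq_zero, eq_comm, div_eq_one_iff_eq hl] at h
  exact h ▸ l.2

lemma sigmaRegular_ne_zero {z : ℂ} (hz : z ∉ L.lattice) : L.sigmaRegular z ≠ 0 := by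
  have hfac := L.sigma_factor_ne_zero hz
  unfold sigmaRegular
  simp_rw [sigma_factor_eq_add] at hfac ⊢
  refine tprod_one_add_ne_zero_of_summable hfac ?_
  refine (L.summable_sigma_bound (‖z‖ + 1)).of_norm_bounded_eventually ?_
  filter_upwards [L.eventually_norm_sigma_factor_sub_one_le (r := ‖z‖ + 1) (by positivity)]
    with l hl
  simpa using hl z (by simp)

lemma sigma_ne_zero {z : ℂ} (hz : z ∉ L.lattice) : L.sigma z ≠ 0 :=
  mul_ne_zero (fun h ↦ hz (h ▸ zero_mem _)) (L.sigmaRegular_ne_zero hz)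

lemma logDeriv_sigma_factor {z : ℂ} (hz : z ∉ L.lattice) (l : L.lattice) :
    logDeriv (fun z ↦ (1 - z / l.1) * Complex.exp (z / l.1 + z ^ 2 / (2 * l.1 ^ 2))) z =
      if l.1 = 0 then 0 else ((z - l.1)⁻¹ + (l.1)⁻¹ + z / l.1 ^ 2) := by
  split_ifs with hl
  · simp [hl, logDeriv_const]
  have hzl : z - l.1 ≠ 0 := fun h ↦ hz (sub_eq_zero.mp h ▸ l.2)
  have hzl' : l.1 - z ≠ 0 := fun h ↦ hz (sub_eq_zero.mp h ▸ l.2)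
  have h1 : HasDerivAt (fun z ↦ 1 - z / l.1) (-(1 / l.1)) z :=
    ((hasDerivAt_id z).div_const l.1).const_sub 1
  have h2 : HasDerivAt (fun z ↦ z / l.1 + z ^ 2 / (2 * l.1 ^ 2)) (1 / l.1 + z / l.1 ^ 2) z := by
    refine (((hasDerivAt_id z).div_const _).add ((hasDerivAt_pow 2 z).div_const _)).congr_deriv ?_
    simp
    field_simp
  rw [logDeriv_apply, (h1.fun_mul h2.cexp).deriv, div_eq_iff (L.sigma_factor_ne_zero hz l)]
  field_simp
  ring

lemma hasDerivAt_sigma {z : ℂ} (hz : z ∉ L.lattice) :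
    HasDerivAt L.sigma (L.sigma z * L.zeta z) z := by
  have hprod := L.hasProdLocallyUniformlyOn_sigmaRegular (r := ‖z‖ + 1) (by positivity)
  have hmem : z ∈ Metric.ball (0 : ℂ) (‖z‖ + 1) := by simp
  have hdiff : DifferentiableAt ℂ L.sigmaRegular z :=
    (hprod.differentiableOn (.of_forall fun s ↦ by fun_prop) Metric.isOpen_ball).differentiableAt
      (Metric.isOpen_ball.mem_nhds hmem)
  have hlog : logDeriv L.sigmaRegular z = L.zetaRegular z := by
    refine (logDeriv_tprod_eq_tsum Metric.isOpen_ball hmem (L.sigma_factor_ne_zero hz)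
      (fun l ↦ by fun_prop) ?_ hprod.multipliableLocallyUniformlyOn
      (L.sigmaRegular_ne_zero hz)).trans ?_
    · simp_rw [L.logDeriv_sigma_factor hz]
      exact L.hasSumLocallyUniformly_zetaRegular.hasSum.summable
    · simp_rw [L.logDeriv_sigma_factor hz]
      rfl
  have hz0 : z ≠ 0 := fun h ↦ hz (h ▸ zero_mem _)
  rw [logDeriv_apply, div_eq_iff (L.sigmaRegular_ne_zero hz)] at hlog
  refine ((hasDerivAt_id z).mul hdiff.hasDerivAt).congr_deriv ?_
  rw [hlog, sigma, zeta, id]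
  field_simp

open Classical in
/-- The difference of the two sides of the addition theorem `zeta_add_zeta_sub_zeta_sq`,
extended by zero to its removable singularities. -/
noncomputable def zetaAdditionDefect (u z : ℂ) : ℂ :=
  if z ∈ L.lattice ∨ u - z ∈ L.lattice then 0
  else (L.zeta (u - z) + L.zeta z - L.zeta u) ^ 2 -
    (L.weierstrassP (u - z) + L.weierstrassP z + L.weierstrassP u)

open Classical in
lemma zetaAdditionDefect_sub (u z : ℂ) :
    L.zetaAdditionDefect u (u - z) = L.zetaAdditionDefect u z := by
  unfold zetaAdditionDefect
  rw [sub_sub_cancel, add_comm (L.zeta z), add_comm (L.weierstrassP z)]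
  exact if_congr or_comm rfl rfl

lemma zetaAdditionDefect_add_coe (u z : ℂ) (l : L.lattice) :
    L.zetaAdditionDefect u (z + l) = L.zetaAdditionDefect u z := by
  have h1 : z + l ∈ L.lattice ↔ z ∈ L.lattice := L.lattice.add_mem_iff_left l.2
  have h2 : u - (z + l) ∈ L.lattice ↔ u - z ∈ L.lattice := by
    rw [← sub_sub]
    exact L.lattice.sub_mem_iff_left l.2
  unfold zetaAdditionDefect
  rw [h1, h2]
  split_ifs with h
  · rfl
  obtain ⟨hz, huz⟩ := not_or.mp h
  obtain ⟨η, hη⟩ := L.exists_zeta_add_coe l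
  have hζ := hη (u - (z + l)) (h2.not.mpr huz)
  rw [show u - (z + l) + l = u - z by ring] at hζ
  rw [hη z hz, hζ, L.weierstrassP_add_coe,
    show L.weierstrassP (u - (z + l)) = L.weierstrassP (u - z) by
      rw [← sub_sub, L.weierstrassP_sub_coe]]
  ring

lemma differentiableAt_zetaAdditionDefect_of_notMem {u z : ℂ} (hz : z ∉ L.lattice)
    (huz : u - z ∉ L.lattice) : DifferentiableAt ℂ (L.zetaAdditionDefect u) z := by
  have hP {w : ℂ} (hw : w ∉ L.lattice) : DifferentiableAt ℂ L.weierstrassP w :=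
    (L.analyticOnNhd_weierstrassP w hw).differentiableAt
  have hsub : DifferentiableAt ℂ (fun z ↦ u - z) z := by fun_prop
  have h1 := (hP huz).comp z hsub
  have h2 := (L.hasDerivAt_zeta huz).differentiableAt.comp z hsub
  refine ((((h2.add (L.hasDerivAt_zeta hz).differentiableAt).sub_const (L.zeta u)).pow 2).sub
    ((h1.add (hP hz)).add_const (L.weierstrassP u))).congr_of_eventuallyEq ?_
  have hopen := L.isClosed_lattice.isOpen_compl
  filter_upwards [hopen.mem_nhds hz, hsub.continuousAt.preimage_mem_nhds (hopen.mem_nhds huz)]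
    with w hw huw
  exact if_neg (not_or.mpr ⟨hw, huw⟩)

lemma continuousAt_zetaAdditionDefect_zero {u : ℂ} (hu : u ∉ L.lattice) :
    ContinuousAt (L.zetaAdditionDefect u) 0 := by
  have hsub : HasDerivAt (fun z ↦ u - z) (-1) 0 := (hasDerivAt_id 0).const_sub u
  have hu' : u - 0 ∉ L.lattice := by simpa
  set k : ℂ → ℂ := fun z ↦ L.zeta (u - z) - L.zeta u + L.zetaRegular z with hk
  have hk0 : k 0 = 0 := by simp [hk]
  have hkderiv : HasDerivAt k (L.weierstrassP u) 0 := by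
    refine ((((L.hasDerivAt_zeta hu').comp 0 hsub).sub_const (L.zeta u)).add
      (L.hasDerivAt_zetaRegular (z := 0) (by simp))).congr_deriv ?_
    simp
  have hslope : Tendsto (fun z ↦ k z / z) (𝓝[≠] 0) (𝓝 (L.weierstrassP u)) := by
    refine (hasDerivAt_iff_tendsto_slope.mp hkderiv).congr fun z ↦ ?_
    simp [slope_def_field, hk0]
  have hcont {f : ℂ → ℂ} (hf : ContinuousAt f 0) : Tendsto f (𝓝[≠] 0) (𝓝 (f 0)) :=
    hf.tendsto.mono_left nhdsWithin_le_nhds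
  have hPu : ContinuousAt (fun z ↦ L.weierstrassP (u - z)) 0 :=
    ContinuousAt.comp (f := fun z ↦ u - z)
      (L.analyticOnNhd_weierstrassP _ hu').continuousAt hsub.continuousAt
  have hlim := (((hslope.const_mul 2).add (hcont (hkderiv.continuousAt.pow 2))).sub
    (((hcont hPu).add (hcont (L.analyticAt_weierstrassPExcept 0).continuousAt)).add_const
      (L.weierstrassP u)))
  have hval : L.zetaAdditionDefect u 0 = 0 := if_pos (by simp)
  rw [← continuousWithinAt_compl_self, ContinuousWithinAt, hval]
  have h0 : 2 * L.weierstrassP u + (k ^ 2) 0 -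
      (L.weierstrassP (u - 0) + L.weierstrassPExcept 0 0 + L.weierstrassP u) = 0 := by
    simp only [Pi.pow_apply, hk0, sub_zero, weierstrassPExcept_zero]
    ring
  rw [h0] at hlim
  refine hlim.congr' ?_
  have hnear := L.compl_lattice_sdiff_singleton_mem_nhds 0
  have hunear := hsub.continuousAt.preimage_mem_nhds
    (L.isClosed_lattice.isOpen_compl.mem_nhds hu')
  filter_upwards [nhdsWithin_le_nhds hnear, nhdsWithin_le_nhds hunear, self_mem_nhdsWithin]
    with z hz huz hz0
  have hz0 : z ≠ 0 := hz0
  have hzL : z ∉ L.lattice := fun h ↦ hz ⟨h, hz0⟩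
  have huz : u - z ∉ L.lattice := huz
  rw [zetaAdditionDefect, if_neg (not_or.mpr ⟨hzL, huz⟩), Pi.pow_apply,
    show L.zeta z = z⁻¹ + L.zetaRegular z from rfl,
    L.weierstrassP_eq_add_weierstrassPExcept_zero z, hk]
  field_simp
  ring

lemma differentiableAt_zetaAdditionDefect_of_mem {u z : ℂ} (hu : u ∉ L.lattice)
    (hz : z ∈ L.lattice) : DifferentiableAt ℂ (L.zetaAdditionDefect u) z := by
  have h0 : DifferentiableAt ℂ (L.zetaAdditionDefect u) (z - z) := by
    rw [sub_self]
    refine (Complex.analyticAt_of_differentiable_on_punctured_nhds_of_continuousAt ?_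
      (L.continuousAt_zetaAdditionDefect_zero hu)).differentiableAt
    have hunear : (fun z ↦ u - z) ⁻¹' (L.lattice : Set ℂ)ᶜ ∈ 𝓝 0 :=
      ContinuousAt.preimage_mem_nhds (by fun_prop)
        (L.isClosed_lattice.isOpen_compl.mem_nhds (by simpa))
    filter_upwards [nhdsWithin_le_nhds (L.compl_lattice_sdiff_singleton_mem_nhds 0),
      nhdsWithin_le_nhds hunear, self_mem_nhdsWithin] with w hw huw hw0
    exact L.differentiableAt_zetaAdditionDefect_of_notMem (fun h ↦ hw ⟨h, hw0⟩) huw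
  refine (h0.comp (f := fun w ↦ w - z) z (by fun_prop)).congr_of_eventuallyEq (.of_forall ?_)
  intro w
  simpa using L.zetaAdditionDefect_add_coe u (w - z) ⟨z, hz⟩

lemma differentiable_zetaAdditionDefect {u : ℂ} (hu : u ∉ L.lattice) :
    Differentiable ℂ (L.zetaAdditionDefect u) := by
  intro z
  by_cases hz : z ∈ L.lattice
  · exact L.differentiableAt_zetaAdditionDefect_of_mem hu hz
  by_cases huz : u - z ∈ L.lattice
  · refine ((L.differentiableAt_zetaAdditionDefect_of_mem hu huz).comp (f := fun w ↦ u - w) z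
      (by fun_prop)).congr_of_eventuallyEq (.of_forall fun w ↦ ?_)
    exact (L.zetaAdditionDefect_sub u w).symm
  · exact L.differentiableAt_zetaAdditionDefect_of_notMem hz huz

/-- The addition theorem for the Weierstrass functions. -/
lemma zeta_add_zeta_sub_zeta_sq {u z : ℂ} (hu : u ∉ L.lattice) (hz : z ∉ L.lattice)
    (huz : u - z ∉ L.lattice) :
    (L.zeta (u - z) + L.zeta z - L.zeta u) ^ 2 =
      L.weierstrassP (u - z) + L.weierstrassP z + L.weierstrassP u := by
  have hdiff := L.differentiable_zetaAdditionDefect hu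
  have hconst := (hdiff.apply_eq_apply_of_bounded
    (IsZLattice.isCompact_range_of_periodic L.lattice _ hdiff.continuous fun w v hv ↦
      L.zetaAdditionDefect_add_coe u w ⟨v, hv⟩).isBounded z 0).trans (if_pos (by simp))
  rwa [zetaAdditionDefect, if_neg (not_or.mpr ⟨hz, huz⟩), sub_eq_zero] at hconst

end PeriodPair

lemma mem_wLattice_iff_mem_lattice (L : PeriodPair) {z : ℂ} :
    z ∈ wLattice L.ω₁ L.ω₂ ↔ z ∈ L.lattice := by
  rw [wLattice, PeriodPair.lattice, ← Submodule.mem_toAddSubgroup,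
    Submodule.span_int_eq_addSubgroupClosure]

/-- The inclusion of the nonzero lattice points into the lattice. -/
def wLatticeStar.toLattice (L : PeriodPair) (w : wLatticeStar L.ω₁ L.ω₂) : L.lattice :=
  ⟨w.1, (mem_wLattice_iff_mem_lattice L).mp w.2.1⟩

lemma wLatticeStar.toLattice_injective (L : PeriodPair) :
    Function.Injective (wLatticeStar.toLattice L) :=
  fun _ _ h ↦ Subtype.ext (congrArg (fun l : L.lattice ↦ l.1) h)

lemma wLatticeStar.mem_range_toLattice (L : PeriodPair) {l : L.lattice} (hl : l.1 ≠ 0) :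
    l ∈ Set.range (wLatticeStar.toLattice L) :=
  ⟨⟨l.1, (mem_wLattice_iff_mem_lattice L).mpr l.2, hl⟩, rfl⟩

lemma wSigma_eq_sigma (L : PeriodPair) : wSigma L.ω₁ L.ω₂ = L.sigma := by
  ext z
  rw [wSigma, PeriodPair.sigma, PeriodPair.sigmaRegular,
    ← (wLatticeStar.toLattice_injective L).tprod_eq]
  · rfl
  · refine fun l hl ↦ wLatticeStar.mem_range_toLattice L fun h ↦ hl ?_
    simp [h]

lemma wZeta_eq_zeta (L : PeriodPair) : wZeta L.ω₁ L.ω₂ = L.zeta := by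
  ext z
  rw [wZeta, PeriodPair.zeta, PeriodPair.zetaRegular,
    ← (wLatticeStar.toLattice_injective L).tsum_eq]
  · congr! 3 with w
    exact (if_neg w.2.2).symm
  · refine fun l hl ↦ wLatticeStar.mem_range_toLattice L fun h ↦ hl ?_
    simp [h]

lemma wP_eq_weierstrassP (L : PeriodPair) : wP L.ω₁ L.ω₂ = L.weierstrassP := by
  ext z
  rw [wP, PeriodPair.weierstrassP_eq_add_weierstrassPExcept_zero, PeriodPair.weierstrassPExcept,
    ← (wLatticeStar.toLattice_injective L).tsum_eq]
  · congr! 3 with w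
    rw [← one_div, ← one_div]
    exact (if_neg w.2.2).symm
  · refine fun l hl ↦ wLatticeStar.mem_range_toLattice L fun h ↦ hl ?_
    simp [h]

lemma cmF_ne_zero (L : PeriodPair) {u x : ℂ} (hu : u ∉ L.lattice) (hx : x ∉ L.lattice)
    (hux : u - x ∉ L.lattice) : cmF L.ω₁ L.ω₂ u x ≠ 0 := by
  rw [cmF, wSigma_eq_sigma]
  exact div_ne_zero (mul_ne_zero (L.sigma_ne_zero hux) (Complex.exp_ne_zero _))
    (mul_ne_zero (L.sigma_ne_zero hu) (L.sigma_ne_zero hx))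

lemma hasDerivAt_cmF (L : PeriodPair) {u x : ℂ} (hu : u ∉ L.lattice) (hx : x ∉ L.lattice)
    (hux : u - x ∉ L.lattice) :
    HasDerivAt (cmF L.ω₁ L.ω₂ u)
      (cmF L.ω₁ L.ω₂ u x * (L.zeta u - L.zeta (u - x) - L.zeta x)) x := by
  have hσu := L.sigma_ne_zero hu
  have hσx := L.sigma_ne_zero hx
  have h1 : HasDerivAt (fun x ↦ L.sigma (u - x)) (L.sigma (u - x) * L.zeta (u - x) * -1) x :=
    (L.hasDerivAt_sigma hux).comp x ((hasDerivAt_id x).const_sub u)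
  have h2 : HasDerivAt (fun x ↦ Complex.exp (L.zeta u * x))
      (Complex.exp (L.zeta u * x) * (L.zeta u * 1)) x :=
    ((hasDerivAt_id x).const_mul (L.zeta u)).cexp
  unfold cmF
  rw [wSigma_eq_sigma, wZeta_eq_zeta]
  refine ((h1.fun_mul h2).fun_div ((L.hasDerivAt_sigma hx).const_mul (L.sigma u))
    (mul_ne_zero hσu hσx)).congr_deriv ?_
  field_simp
  ring

/-- The function `z(x) = f''(x)/(2 f(x))` equals `℘(x) + ℘(u)/2`. -/
theorem cmF_second_log_derivative (ω₁ ω₂ u x : ℂ)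
    (hω : LinearIndependent ℝ ![ω₁, ω₂])
    (hu : u ∉ wLattice ω₁ ω₂) (hx : x ∉ wLattice ω₁ ω₂)
    (hux : u - x ∉ wLattice ω₁ ω₂) :
    deriv (deriv (cmF ω₁ ω₂ u)) x / (2 * cmF ω₁ ω₂ u x) =
      wP ω₁ ω₂ x + wP ω₁ ω₂ u / 2 := by
  obtain ⟨L, rfl, rfl⟩ : ∃ L : PeriodPair, L.ω₁ = ω₁ ∧ L.ω₂ = ω₂ := ⟨⟨ω₁, ω₂, hω⟩, rfl, rfl⟩
  rw [mem_wLattice_iff_mem_lattice] at hu hx hux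
  have hsub : HasDerivAt (fun x ↦ u - x) (-1) x := (hasDerivAt_id x).const_sub u
  have hopen := L.isClosed_lattice.isOpen_compl
  have hderiv : deriv (cmF L.ω₁ L.ω₂ u) =ᶠ[𝓝 x]
      fun x ↦ cmF L.ω₁ L.ω₂ u x * (L.zeta u - L.zeta (u - x) - L.zeta x) := by
    filter_upwards [hopen.mem_nhds hx, hsub.continuousAt.preimage_mem_nhds (hopen.mem_nhds hux)]
      with y hy huy
    exact (hasDerivAt_cmF L hu hy huy).deriv
  have hζ : HasDerivAt (fun x ↦ L.zeta u - L.zeta (u - x) - L.zeta x)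
      (-(-L.weierstrassP (u - x) * -1) - -L.weierstrassP x) x :=
    (((L.hasDerivAt_zeta hux).comp x hsub).const_sub (L.zeta u)).sub (L.hasDerivAt_zeta hx)
  rw [hderiv.deriv_eq, ((hasDerivAt_cmF L hu hx hux).fun_mul hζ).deriv, wP_eq_weierstrassP,
    div_eq_iff (mul_ne_zero two_ne_zero (cmF_ne_zero L hu hx hux))]
  linear_combination cmF L.ω₁ L.ω₂ u x * L.zeta_add_zeta_sub_zeta_sq hu hx hux
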